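/- The trivial trisection of S³ exists: there are three closed subsets H₁, H₂, H₃ of the unit sphere S³ in ℝ⁴ whose union is all of S³, such that each Hᵢ is homeomorphic to the closed unit ball in ℝ³, each pairwise intersection Hᵢ ∩ Hⱼ (i ≠ j) is homeomorphic to the closed unit disk in ℝ², and the triple intersection H₁ ∩ H₂ ∩ H₃ is homeomorphic to the unit circle S¹ in ℝ². -/

import Mathlib

open Metric

/-- A homeomorphism between a subset `s` of the unit sphere and a set `t`, from continuous maps of
the ambient spaces that restrict to mutually inverse maps between `s` and `t`. -/
def sphereSubsetHomeomorph {E F : Type*} [NormedAddCommGroup E] [TopologicalSpace F]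
    {s : Set (sphere (0 : E) 1)} {t : Set F} (f : E → F) (g : F → E)
    (hf : Continuous f) (hg : Continuous g)
    (hst : ∀ x ∈ s, f x ∈ t) (hts : ∀ y ∈ t, ∃ h : g y ∈ sphere (0 : E) 1, ⟨g y, h⟩ ∈ s)
    (hgf : ∀ x ∈ s, g (f x) = x) (hfg : ∀ y ∈ t, f (g y) = y) : s ≃ₜ t where
  toFun x := ⟨f x, hst _ x.2⟩
  invFun y := ⟨⟨g y, (hts _ y.2).1⟩, (hts _ y.2).2⟩
  left_inv x := Subtype.ext (Subtype.ext (hgf _ x.2))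
  right_inv y := Subtype.ext (hfg _ y.2)
  continuous_toFun := by fun_prop
  continuous_invFun := by fun_prop

theorem EuclideanSpace.norm_le_one_iff_sum_sq {n : ℕ} (x : EuclideanSpace ℝ (Fin n)) :
    ‖x‖ ≤ 1 ↔ ∑ i, x i ^ 2 ≤ 1 := by
  rw [← EuclideanSpace.real_norm_sq_eq, sq_le_one_iff₀ (norm_nonneg x)]

theorem EuclideanSpace.norm_eq_one_iff_sum_sq {n : ℕ} (x : EuclideanSpace ℝ (Fin n)) :
    ‖x‖ = 1 ↔ ∑ i, x i ^ 2 = 1 := by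
  rw [← EuclideanSpace.real_norm_sq_eq, pow_eq_one_iff_of_nonneg (norm_nonneg x) two_ne_zero]

/-- The half of the closed unit ball on which `ε * x 2 ≥ 0` is homeomorphic to the whole ball. -/
theorem nonempty_halfBall_homeomorph_closedBall {ε : ℝ} (hε : ε ^ 2 = 1) :
    Nonempty ({x : EuclideanSpace ℝ (Fin 3) | ‖x‖ ≤ 1 ∧ 0 ≤ ε * x 2} ≃ₜ
      closedBall (0 : EuclideanSpace ℝ (Fin 3)) 1) := by
  set K : Set (EuclideanSpace ℝ (Fin 3)) := {x | ‖x‖ ≤ 1 ∧ 0 ≤ ε * x 2} with hK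
  have hKeq : K = closedBall 0 1 ∩ {x | 0 ≤ ε * x 2} := by ext; simp [hK]
  have hclosed : IsClosed K := by
    rw [hKeq]
    exact isClosed_closedBall.inter (isClosed_le (by fun_prop) (by fun_prop))
  have hconvex : Convex ℝ K := by
    rw [hKeq]
    refine (convex_closedBall _ _).inter fun x hx y hy a b ha hb _ => ?_
    simp only [Set.mem_ofPred_eq, PiLp.add_apply, PiLp.smul_apply, smul_eq_mul] at *
    nlinarith [mul_nonneg ha hx, mul_nonneg hb hy]
  have hbounded : Bornology.IsBounded K :=
    isBounded_closedBall.subset (hKeq ▸ Set.inter_subset_left)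
  have hinterior : (interior K).Nonempty := by
    have hopen : IsOpen {x : EuclideanSpace ℝ (Fin 3) | ‖x‖ < 1 ∧ 0 < ε * x 2} := by
      rw [Set.ofPred_and]
      exact (isOpen_lt (by fun_prop) (by fun_prop)).inter
        (isOpen_lt (by fun_prop) (by fun_prop))
    have hsub : {x : EuclideanSpace ℝ (Fin 3) | ‖x‖ < 1 ∧ 0 < ε * x 2} ⊆ K :=
      fun x hx => ⟨hx.1.le, hx.2.le⟩
    refine ⟨!₂[0, 0, ε / 2], interior_maximal hsub hopen ⟨?_, ?_⟩⟩
    · rw [← sq_lt_one_iff₀ (norm_nonneg _), EuclideanSpace.real_norm_sq_eq]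
      simp only [Fin.sum_univ_three, Matrix.cons_val]
      nlinarith
    · simp
      nlinarith
  obtain ⟨h, -, hcl, -⟩ := exists_homeomorph_image_interior_closure_frontier_eq_unitBall
    hconvex hinterior hbounded
  rw [hclosed.closure_eq] at hcl
  exact ⟨(h.image K).trans (Homeomorph.setCongr hcl)⟩

/-- The part of the hemisphere `ε * x 2 ≥ 0` whose last coordinate satisfies `P` projects
homeomorphically onto the part of the closed unit ball whose last coordinate satisfies `P`. -/
theorem nonempty_graph_homeomorph_ball {ε : ℝ} (hε : ε ^ 2 = 1) (P : ℝ → Prop) :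
    Nonempty ({x : sphere (0 : EuclideanSpace ℝ (Fin 4)) 1 | 0 ≤ ε * x.1 2 ∧ P (x.1 3)} ≃ₜ
      {x : EuclideanSpace ℝ (Fin 3) | ‖x‖ ≤ 1 ∧ P (x 2)}) := by
  refine ⟨sphereSubsetHomeomorph (fun x => !₂[x 0, x 1, x 3])
    (fun x => !₂[x 0, x 1, ε * √(1 - (x 0 ^ 2 + x 1 ^ 2 + x 2 ^ 2)), x 2])
    (by fun_prop) (by fun_prop) ?_ ?_ ?_ ?_⟩
  · rintro ⟨x, hx⟩ ⟨h, hP⟩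
    rw [mem_sphere_zero_iff_norm, EuclideanSpace.norm_eq_one_iff_sum_sq, Fin.sum_univ_four] at hx
    refine ⟨?_, by simpa using hP⟩
    rw [EuclideanSpace.norm_le_one_iff_sum_sq, Fin.sum_univ_three]
    simp
    nlinarith [sq_nonneg (x 2)]
  · rintro x ⟨hx, hP⟩
    rw [EuclideanSpace.norm_le_one_iff_sum_sq, Fin.sum_univ_three] at hx
    refine ⟨?_, ?_, by simpa using hP⟩
    · rw [mem_sphere_zero_iff_norm, EuclideanSpace.norm_eq_one_iff_sum_sq, Fin.sum_univ_four]
      simp [mul_pow, hε, Real.sq_sqrt (sub_nonneg.2 hx)]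
      ring
    · simp [← mul_assoc, ← sq, hε]
  · rintro ⟨x, hx⟩ ⟨h, hP⟩
    rw [mem_sphere_zero_iff_norm, EuclideanSpace.norm_eq_one_iff_sum_sq, Fin.sum_univ_four] at hx
    have hroot : √(1 - (x 0 ^ 2 + x 1 ^ 2 + x 3 ^ 2)) = ε * x 2 := by
      rw [← Real.sqrt_sq h, mul_pow, hε]
      congr 1
      linarith
    ext i
    fin_cases i <;> simp [hroot, ← mul_assoc, ← sq, hε]
  · rintro x -
    ext i
    fin_cases i <;> simp

/-- The half of the equatorial 2-sphere `x i = 0` on which `ε * x j ≥ 0`, where `i` and `j` are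
the last two coordinates in either order, is homeomorphic to the closed disk. -/
theorem nonempty_halfSphere_homeomorph_disk {ε : ℝ} (hε : ε ^ 2 = 1) {i j : Fin 4}
    (hij : i = 2 ∧ j = 3 ∨ i = 3 ∧ j = 2) :
    Nonempty ({x : sphere (0 : EuclideanSpace ℝ (Fin 4)) 1 | x.1 i = 0 ∧ 0 ≤ ε * x.1 j} ≃ₜ
      closedBall (0 : EuclideanSpace ℝ (Fin 2)) 1) := by
  refine ⟨sphereSubsetHomeomorph (fun x => !₂[x 0, x 1])
    (fun x => !₂[x 0, x 1, if j = 2 then ε * √(1 - (x 0 ^ 2 + x 1 ^ 2)) else 0,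
      if j = 3 then ε * √(1 - (x 0 ^ 2 + x 1 ^ 2)) else 0])
    (by fun_prop) (by rcases hij with ⟨rfl, rfl⟩ | ⟨rfl, rfl⟩ <;> simp <;> fun_prop) ?_ ?_ ?_ ?_⟩
  · rintro ⟨x, hx⟩ -
    rw [mem_sphere_zero_iff_norm, EuclideanSpace.norm_eq_one_iff_sum_sq, Fin.sum_univ_four] at hx
    rw [mem_closedBall_zero_iff, EuclideanSpace.norm_le_one_iff_sum_sq, Fin.sum_univ_two]
    simp
    nlinarith [sq_nonneg (x 2), sq_nonneg (x 3)]
  · intro x hx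
    rw [mem_closedBall_zero_iff, EuclideanSpace.norm_le_one_iff_sum_sq, Fin.sum_univ_two] at hx
    refine ⟨?_, ?_⟩
    · rw [mem_sphere_zero_iff_norm, EuclideanSpace.norm_eq_one_iff_sum_sq, Fin.sum_univ_four]
      rcases hij with ⟨rfl, rfl⟩ | ⟨rfl, rfl⟩ <;>
        simp [mul_pow, hε, Real.sq_sqrt (sub_nonneg.2 hx)]
    · rcases hij with ⟨rfl, rfl⟩ | ⟨rfl, rfl⟩ <;> simp [← mul_assoc, ← sq, hε]
  · rintro ⟨x, hx⟩ ⟨h0, h⟩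
    rw [mem_sphere_zero_iff_norm, EuclideanSpace.norm_eq_one_iff_sum_sq, Fin.sum_univ_four] at hx
    have hroot : √(1 - (x 0 ^ 2 + x 1 ^ 2)) = ε * x j := by
      rw [← Real.sqrt_sq h, mul_pow, hε]
      congr 1
      rcases hij with ⟨rfl, rfl⟩ | ⟨rfl, rfl⟩ <;> simp_all <;> linarith
    ext k
    rcases hij with ⟨rfl, rfl⟩ | ⟨rfl, rfl⟩ <;> dsimp only at h0 <;> fin_cases k <;>
      simp [hroot, h0, hε, ← mul_assoc, ← sq]
  · rintro x -
    ext k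
    fin_cases k <;> simp

/-- The great circle cut out by the vanishing of the last two coordinates. -/
theorem nonempty_greatCircle_homeomorph_circle :
    Nonempty ({x : sphere (0 : EuclideanSpace ℝ (Fin 4)) 1 | x.1 2 = 0 ∧ x.1 3 = 0} ≃ₜ
      sphere (0 : EuclideanSpace ℝ (Fin 2)) 1) := by
  refine ⟨sphereSubsetHomeomorph (fun x => !₂[x 0, x 1]) (fun x => !₂[x 0, x 1, 0, 0])
    (by fun_prop) (by fun_prop) ?_ ?_ ?_ ?_⟩
  · rintro ⟨x, hx⟩ ⟨h2 : x 2 = 0, h3 : x 3 = 0⟩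
    rw [mem_sphere_zero_iff_norm, EuclideanSpace.norm_eq_one_iff_sum_sq] at *
    simpa [Fin.sum_univ_four, Fin.sum_univ_two, h2, h3] using hx
  · intro x hx
    refine ⟨?_, by simp⟩
    rw [mem_sphere_zero_iff_norm, EuclideanSpace.norm_eq_one_iff_sum_sq] at *
    simpa [Fin.sum_univ_four, Fin.sum_univ_two] using hx
  · rintro ⟨x, hx⟩ ⟨h2, h3⟩
    ext k
    fin_cases k <;> simp_all
  · rintro x -
    ext k
    fin_cases k <;> simp

/-- The trivial trisection of `S³`: three closed subsets of the unit sphere in `ℝ⁴`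
covering it, each homeomorphic to the closed unit 3-ball, with pairwise intersections
homeomorphic to the closed unit 2-disk and triple intersection homeomorphic to the
unit circle. -/
theorem trivial_trisection_S3 :
    ∃ H₁ H₂ H₃ : Set (Metric.sphere (0 : EuclideanSpace ℝ (Fin 4)) 1),
      IsClosed H₁ ∧ IsClosed H₂ ∧ IsClosed H₃ ∧
      H₁ ∪ H₂ ∪ H₃ = Set.univ ∧
      Nonempty (H₁ ≃ₜ Metric.closedBall (0 : EuclideanSpace ℝ (Fin 3)) 1) ∧
      Nonempty (H₂ ≃ₜ Metric.closedBall (0 : EuclideanSpace ℝ (Fin 3)) 1) ∧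
      Nonempty (H₃ ≃ₜ Metric.closedBall (0 : EuclideanSpace ℝ (Fin 3)) 1) ∧
      Nonempty ((H₁ ∩ H₂ : Set _) ≃ₜ Metric.closedBall (0 : EuclideanSpace ℝ (Fin 2)) 1) ∧
      Nonempty ((H₁ ∩ H₃ : Set _) ≃ₜ Metric.closedBall (0 : EuclideanSpace ℝ (Fin 2)) 1) ∧
      Nonempty ((H₂ ∩ H₃ : Set _) ≃ₜ Metric.closedBall (0 : EuclideanSpace ℝ (Fin 2)) 1) ∧
      Nonempty ((H₁ ∩ H₂ ∩ H₃ : Set _) ≃ₜ Metric.sphere (0 : EuclideanSpace ℝ (Fin 2)) 1) := by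
  have hneg : (-1 : ℝ) ^ 2 = 1 := by norm_num
  have hpos : (1 : ℝ) ^ 2 = 1 := by norm_num
  refine ⟨{x | 0 ≤ -1 * x.1 2 ∧ True}, {x | 0 ≤ 1 * x.1 2 ∧ 0 ≤ 1 * x.1 3},
    {x | 0 ≤ 1 * x.1 2 ∧ 0 ≤ -1 * x.1 3}, ?_, ?_, ?_, ?_, ?_, ?_, ?_, ?_, ?_, ?_, ?_⟩
  · simp only [and_true]
    exact isClosed_le (by fun_prop) (by fun_prop)
  · rw [Set.ofPred_and]
    exact (isClosed_le (by fun_prop) (by fun_prop)).inter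
      (isClosed_le (by fun_prop) (by fun_prop))
  · rw [Set.ofPred_and]
    exact (isClosed_le (by fun_prop) (by fun_prop)).inter
      (isClosed_le (by fun_prop) (by fun_prop))
  · ext x
    simp only [Set.mem_union, Set.mem_ofPred_eq, Set.mem_univ, iff_true]
    rcases le_total 0 (x.1 2) with h | h <;> rcases le_total 0 (x.1 3) with h' | h' <;> simp [h, h']
  · obtain ⟨e⟩ := nonempty_graph_homeomorph_ball hneg fun _ => True
    exact ⟨e.trans (Homeomorph.setCongr (by ext; simp))⟩
  · obtain ⟨e⟩ := nonempty_graph_homeomorph_ball hpos fun t => 0 ≤ 1 * t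
    exact (nonempty_halfBall_homeomorph_closedBall hpos).map e.trans
  · obtain ⟨e⟩ := nonempty_graph_homeomorph_ball hpos fun t => 0 ≤ -1 * t
    exact (nonempty_halfBall_homeomorph_closedBall hneg).map e.trans
  · refine (nonempty_halfSphere_homeomorph_disk hpos (.inl ⟨rfl, rfl⟩)).map
      (Homeomorph.setCongr ?_).trans
    ext x
    simp only [Set.mem_inter_iff, Set.mem_ofPred_eq]
    grind
  · refine (nonempty_halfSphere_homeomorph_disk hneg (.inl ⟨rfl, rfl⟩)).map
      (Homeomorph.setCongr ?_).trans
    ext x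
    simp only [Set.mem_inter_iff, Set.mem_ofPred_eq]
    grind
  · refine (nonempty_halfSphere_homeomorph_disk hpos (.inr ⟨rfl, rfl⟩)).map
      (Homeomorph.setCongr ?_).trans
    ext x
    simp only [Set.mem_inter_iff, Set.mem_ofPred_eq]
    grind
  · refine nonempty_greatCircle_homeomorph_circle.map (Homeomorph.setCongr ?_).trans
    ext x
    simp only [Set.mem_inter_iff, Set.mem_ofPred_eq]
    grind
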